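/- arXiv:1012.3053 — 4 statements merged into one kernel-verified Lean document; each statement's English description precedes it below -/
import Mathlib

section
/- The cornered hull of the tropical matroid polytope P equals the d-dimensional tropical standard simplex Δ^d = tconv{−e_1,…,−e_{d+1}}; explicitly, tconv{−e_1,…,−e_{d+1}} = {x ∈ 𝕋^d : x_i − 1 ≤ min_{j≠i} x_j for all i ∈ [d+1]}. -/
open Finset

noncomputable section

variable {d n : ℕ}

/-- `x ∈ tconv {v i}`, at the level of representatives in `ℝ^{d+1}` modulo constants. -/
def InTconv {ι : Type*} (v : ι → Fin (d + 1) → ℝ) (x : Fin (d + 1) → ℝ) : Prop :=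
  ∃ (lam : ι → ℝ) (c : ℝ), ∀ j, x j + c = ⨅ i, (lam i + v i j)

/-- the `k`-th entry of the type of `x` with respect to the generators `v` -/
def typeEntry {ι : Type*} (v : ι → Fin (d + 1) → ℝ) (x : Fin (d + 1) → ℝ)
    (k : Fin (d + 1)) : Set ι :=
  {i | v i k - x k = ⨅ j, (v i j - x j)}

/-- the spanning subgraph of `G` whose edges are those indexed by `B` -/
def edgeGraph {W : Type*} (G : SimpleGraph W) (ε : Fin (d + 1) ≃ G.edgeSet)
    (B : Finset (Fin (d + 1))) : SimpleGraph W :=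
  SimpleGraph.fromEdgeSet {s | ∃ i ∈ B, (ε i : Sym2 W) = s}

/-- `B ⊆ [d+1]` is the edge set of a spanning tree of `G` -/
def IsSpanningTreeEdges {W : Type*} (G : SimpleGraph W) (ε : Fin (d + 1) ≃ G.edgeSet)
    (B : Finset (Fin (d + 1))) : Prop :=
  (edgeGraph G ε B).IsTree

/-- generators of the tropical matroid polytope, in canonical coordinates -/
def gen (Bs : Fin n → Finset (Fin (d + 1))) (l : Fin n) (i : Fin (d + 1)) : ℝ :=
  if i ∈ Bs l then 0 else 1

/-- data of the cycle matroid of a connected bridgeless simple graph `G` whose `d+1` edges are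
enumerated by `ε` and whose bases (spanning-tree edge sets, each of rank/cardinality `k`) are
enumerated without repetition by `Bs`. -/
structure MatroidData (d n k : ℕ) (W : Type) (G : SimpleGraph W)
    (ε : Fin (d + 1) ≃ G.edgeSet) (Bs : Fin n → Finset (Fin (d + 1))) : Prop where
  connected : G.Connected
  bridgeless : ∀ i : Fin (d + 1), ¬ G.IsBridge (ε i : Sym2 W)
  tree : ∀ l, IsSpanningTreeEdges G ε (Bs l)
  inj : Function.Injective Bs
  all : ∀ B : Finset (Fin (d + 1)), IsSpanningTreeEdges G ε B → ∃ l, Bs l = B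
  card : ∀ l, (Bs l).card = k

/-- minimum of `f` over a subset of coordinates (as an infimum) -/
def tmin (I : Set (Fin (d + 1))) (f : Fin (d + 1) → ℝ) : ℝ := sInf (f '' I)

/-- the closed tropical halfspace with apex `p` and type `I` -/
def Halfspace (p : Fin (d + 1) → ℝ) (I : Set (Fin (d + 1))) : Set (Fin (d + 1) → ℝ) :=
  {x | tmin I (fun i => x i - p i) ≤ tmin Iᶜ (fun j => x j - p j)}

/-- the closed cell of the tropical complex containing `p` -/
def closedCell {ι : Type*} (v : ι → Fin (d + 1) → ℝ) (p : Fin (d + 1) → ℝ) :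
    Set (Fin (d + 1) → ℝ) :=
  {x | ∀ k, typeEntry v p k ⊆ typeEntry v x k}

/-- the (closed) cells of the tropical complex `𝒞_V` -/
def IsCell {ι : Type*} (v : ι → Fin (d + 1) → ℝ) (X : Set (Fin (d + 1) → ℝ)) : Prop :=
  ∃ p, X = closedCell v p

/-- the chart `c₀ : 𝕋^d → ℝ^d` -/
def chart (x : Fin (d + 1) → ℝ) (i : Fin d) : ℝ := x i.succ - x 0

/-- a bounded cell of the tropical complex (bounded as a subset of `𝕋^d ≅ ℝ^d`) -/
def IsBoundedCell {ι : Type*} (v : ι → Fin (d + 1) → ℝ) (X : Set (Fin (d + 1) → ℝ)) : Prop :=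
  IsCell v X ∧ Bornology.IsBounded (chart '' X)

/-- an inclusion-maximal bounded cell -/
def IsMaxBoundedCell {ι : Type*} (v : ι → Fin (d + 1) → ℝ) (X : Set (Fin (d + 1) → ℝ)) : Prop :=
  IsBoundedCell v X ∧ ∀ Y, IsBoundedCell v Y → X ⊆ Y → Y = X

/-- an inclusion-maximal cell -/
def IsMaxCell {ι : Type*} (v : ι → Fin (d + 1) → ℝ) (X : Set (Fin (d + 1) → ℝ)) : Prop :=
  IsCell v X ∧ ∀ Y, IsCell v Y → X ⊆ Y → Y = X

/-- a point of the relative interior of a cell `X`: a point of `X` whose type is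
componentwise contained in the type of every point of `X` -/
def IsInteriorPoint {ι : Type*} (v : ι → Fin (d + 1) → ℝ) (X : Set (Fin (d + 1) → ℝ))
    (x : Fin (d + 1) → ℝ) : Prop :=
  x ∈ X ∧ ∀ y ∈ X, ∀ k, typeEntry v x k ⊆ typeEntry v y k

/-- `b_{I,J}`: the number of bases `B` with `I ⊆ B` and `J ∩ B = ∅` -/
def bIJ (Bs : Fin n → Finset (Fin (d + 1))) (I J : Finset (Fin (d + 1))) : ℕ :=
  (Finset.univ.filter fun l => I ⊆ Bs l ∧ Disjoint J (Bs l)).card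

/-- a pseudovertex of the tropical complex: the unique point of `𝕋^d` of its type -/
def IsPseudovertex {ι : Type*} (v : ι → Fin (d + 1) → ℝ) (x : Fin (d + 1) → ℝ) : Prop :=
  ∀ y, (∀ k, typeEntry v y k = typeEntry v x k) → ∃ c : ℝ, y = fun j => x j + c

/-- the pseudovertex `e_{i₁,…,i_s} = -e_J`, `J = [d+1] ∖ {σ 0,…,σ (s-1)}`, in canonical
coordinates: coordinate `1` at `σ 0, …, σ (s-1)` and `0` elsewhere -/
def ptSeq {r : ℕ} (σ : Fin r → Fin (d + 1)) (s : ℕ) (j : Fin (d + 1)) : ℝ :=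
  if ∃ t : Fin r, (t : ℕ) < s ∧ σ t = j then 1 else 0

/-- the generators `-e_I`, `|I| = k`, of the tropical hypersimplex `Δ_k^d`, in
canonical coordinates -/
def genU (d k : ℕ) : {I : Finset (Fin (d + 1)) // I.card = k} → Fin (d + 1) → ℝ :=
  fun I j => if j ∈ I.1 then 0 else 1

/-- the `i`-th corner of the point configuration `v`: `c_i(V)_j = min_l (v_{l,j} - v_{l,i})` -/
def corner {d n : ℕ} (v : Fin n → Fin (d + 1) → ℝ) (i j : Fin (d + 1)) : ℝ :=
  ⨅ l, (v l j - v l i)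

/-- For distinct edges `i`, `j` of a connected bridgeless graph, some spanning tree contains `j`
but not `i`. -/
theorem MatroidData.exists_mem_notMem {d n k : ℕ} {W : Type} {G : SimpleGraph W}
    {ε : Fin (d + 1) ≃ G.edgeSet} {Bs : Fin n → Finset (Fin (d + 1))}
    (hM : MatroidData d n k W G ε Bs) {i j : Fin (d + 1)} (hij : j ≠ i) :
    ∃ l, j ∈ Bs l ∧ i ∉ Bs l := by
  classical
  have hconn : (G.deleteEdges {(ε i : Sym2 W)}).Connected := by
    have hb := hM.bridgeless i
    revert hb
    generalize (ε i : Sym2 W) = e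
    obtain ⟨a, b⟩ := e
    exact fun hb => hM.connected.connected_delete_edge_of_not_isBridge hb
  have hne : (ε j : Sym2 W) ≠ ε i := fun h => hij (ε.injective (Subtype.ext h))
  have hle : SimpleGraph.fromEdgeSet {(ε j : Sym2 W)} ≤ G.deleteEdges {(ε i : Sym2 W)} := by
    rw [SimpleGraph.fromEdgeSet_le, SimpleGraph.edgeSet_deleteEdges]
    rintro _ ⟨rfl, -⟩
    exact ⟨(ε j).2, hne⟩
  have hacyc : (SimpleGraph.fromEdgeSet {(ε j : Sym2 W)}).IsAcyclic := by
    obtain ⟨a, b⟩ := (ε j : Sym2 W)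
    have := (SimpleGraph.isAcyclic_sup_fromEdgeSet_iff (G := ⊥) (u := a) (v := b)).2
      ⟨SimpleGraph.isAcyclic_bot, fun h => Or.inl (by simpa using h)⟩
    rwa [bot_sup_eq] at this
  obtain ⟨F, hjF, hFG, hF⟩ := hconn.exists_isTree_le_of_le_of_isAcyclic hle hacyc
  have hedge : edgeGraph G ε (Finset.univ.filter fun m => (ε m : Sym2 W) ∈ F.edgeSet) = F := by
    rw [edgeGraph, ← F.fromEdgeSet_edgeSet]
    congr 1
    ext s
    simp only [Finset.mem_filter, Finset.mem_univ, true_and, SimpleGraph.fromEdgeSet_edgeSet,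
      Set.mem_ofPred_eq]
    refine ⟨fun ⟨m, hm, h⟩ => h ▸ hm, fun hs => ?_⟩
    have hsG : s ∈ G.edgeSet :=
      SimpleGraph.edgeSet_mono (hFG.trans (SimpleGraph.deleteEdges_le _)) hs
    exact ⟨ε.symm ⟨s, hsG⟩, by simpa using hs, by simp⟩
  obtain ⟨l, hl⟩ := hM.all _ (show IsSpanningTreeEdges G ε _ from hedge.symm ▸ hF)
  refine ⟨l, ?_, ?_⟩
  · rw [hl]
    have : (ε j : Sym2 W) ∈ F.edgeSet := SimpleGraph.edgeSet_mono hjF <| by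
      rw [SimpleGraph.edgeSet_fromEdgeSet]
      exact ⟨rfl, G.not_isDiag_of_mem_edgeSet (ε j).2⟩
    simpa using this
  · rw [hl]
    intro hi
    have := SimpleGraph.edgeSet_mono hFG (Finset.mem_filter.1 hi).2
    rw [SimpleGraph.edgeSet_deleteEdges] at this
    exact this.2 rfl

/-- A graph with an edge and no bridges has at least two edges. -/
theorem MatroidData.nontrivial {d n k : ℕ} {W : Type} {G : SimpleGraph W}
    {ε : Fin (d + 1) ≃ G.edgeSet} {Bs : Fin n → Finset (Fin (d + 1))}
    (hM : MatroidData d n k W G ε Bs) : Nontrivial (Fin (d + 1)) := by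
  by_contra h
  rw [not_nontrivial_iff_subsingleton] at h
  have hdel : G.deleteEdges {(ε 0 : Sym2 W)} = ⊥ := by
    rw [← SimpleGraph.edgeSet_eq_empty, SimpleGraph.edgeSet_deleteEdges]
    refine Set.sdiff_eq_empty.2 fun s hs => ?_
    have : ε.symm ⟨s, hs⟩ = 0 := Subsingleton.elim _ _
    rw [Equiv.symm_apply_eq] at this
    exact congrArg Subtype.val this
  have hb := hM.bridgeless 0
  have hm := (ε 0).2
  revert hb hm hdel
  generalize (ε 0 : Sym2 W) = s
  induction s with
  | h u v =>
    intro hdel hb hm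
    rw [SimpleGraph.isBridge_iff, not_not, hdel, SimpleGraph.reachable_bot] at hb
    exact (G.ne_of_adj hm) hb

theorem MatroidData.corner_gen {d n k : ℕ} {W : Type} {G : SimpleGraph W}
    {ε : Fin (d + 1) ≃ G.edgeSet} {Bs : Fin n → Finset (Fin (d + 1))}
    (hM : MatroidData d n k W G ε Bs) {i j : Fin (d + 1)} (hij : j ≠ i) :
    corner (gen Bs) i j = -1 := by
  obtain ⟨l, hj, hi⟩ := hM.exists_mem_notMem hij
  have : Nonempty (Fin n) := ⟨l⟩
  apply le_antisymm
  · refine (ciInf_le (Set.finite_range _).bddBelow l).trans ?_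
    simp [gen, hj, hi]
  · refine le_ciInf fun m => ?_
    unfold gen
    split_ifs <;> norm_num

theorem corner_self {d n : ℕ} (v : Fin n → Fin (d + 1) → ℝ) (i : Fin (d + 1)) :
    corner v i i = 0 := by
  simp [corner]

theorem le_tmin_iff {d : ℕ} {I : Set (Fin (d + 1))} (hI : I.Nonempty) {f : Fin (d + 1) → ℝ}
    {a : ℝ} : a ≤ tmin I f ↔ ∀ j ∈ I, a ≤ f j := by
  rw [tmin, le_csInf_iff (Set.toFinite _).bddBelow (hI.image f), Set.forall_mem_image]

theorem tmin_singleton {d : ℕ} (i : Fin (d + 1)) (f : Fin (d + 1) → ℝ) : tmin {i} f = f i := by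
  simp [tmin]

/-- The exterior description of the tropical standard simplex. -/
theorem inTconv_neg_unit_iff {d : ℕ} {x : Fin (d + 1) → ℝ} :
    InTconv (fun (i : Fin (d + 1)) (j : Fin (d + 1)) => if j = i then (-1 : ℝ) else 0) x ↔
      ∀ i j, j ≠ i → x i - 1 ≤ x j := by
  constructor
  · rintro ⟨lam, c, h⟩ i j -
    obtain ⟨m, hm⟩ := exists_eq_ciInf_of_finite
      (f := fun m => lam m + if j = m then (-1 : ℝ) else 0)
    have hi : x i + c ≤ lam m + if i = m then (-1 : ℝ) else 0 :=
      (h i).trans_le (ciInf_le (Set.finite_range _).bddBelow m)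
    have hj : x j + c = lam m + if j = m then (-1 : ℝ) else 0 := (h j).trans hm.symm
    split_ifs at hi hj <;> linarith
  · intro h
    refine ⟨fun i => x i + 1, 0, fun j => le_antisymm (le_ciInf fun i => ?_) ?_⟩
    · beta_reduce
      split_ifs with hij
      · simp [hij]
      · linarith [h j i (Ne.symm hij)]
    · exact (ciInf_le (Set.finite_range _).bddBelow j).trans (by simp)

/-- The cornered hull of the tropical matroid polytope (the intersection of
its `d+1` cornered halfspaces `H(c_i(V), {i})`) equals the tropical standard simplex
`Δ^d = tconv{-e_1, …, -e_{d+1}}`, and explicitly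
`Δ^d = {x : x_i - 1 ≤ min_{j ≠ i} x_j for all i}`. -/
theorem corneredHull_tropicalMatroidPolytope
    (d n k : ℕ) (W : Type) [Fintype W] (G : SimpleGraph W)
    (ε : Fin (d + 1) ≃ G.edgeSet) (Bs : Fin n → Finset (Fin (d + 1)))
    (hM : MatroidData d n k W G ε Bs) :
    (⋂ i : Fin (d + 1), Halfspace (fun j => corner (gen Bs) i j) {i}) =
        {x : Fin (d + 1) → ℝ |
          InTconv (fun (i : Fin (d + 1)) (j : Fin (d + 1)) => if j = i then (-1 : ℝ) else 0) x} ∧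
    {x : Fin (d + 1) → ℝ |
        InTconv (fun (i : Fin (d + 1)) (j : Fin (d + 1)) => if j = i then (-1 : ℝ) else 0) x} =
      {x : Fin (d + 1) → ℝ | ∀ i, x i - 1 ≤ tmin {j | j ≠ i} x} := by
  have := hM.nontrivial
  have hne (i : Fin (d + 1)) : {j | j ≠ i}.Nonempty := exists_ne i
  have hcompl (i : Fin (d + 1)) : ({i}ᶜ : Set (Fin (d + 1))) = {j | j ≠ i} := rfl
  constructor
  · ext x
    simp only [Set.mem_iInter, Halfspace, Set.mem_ofPred_eq, tmin_singleton, corner_self, hcompl,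
      le_tmin_iff (hne _), inTconv_neg_unit_iff]
    refine forall_congr' fun i => forall₂_congr fun j hj => ?_
    rw [hM.corner_gen hj, sub_zero, sub_neg_eq_add, sub_le_iff_le_add]
  · ext x
    simp only [Set.mem_ofPred_eq, inTconv_neg_unit_iff, le_tmin_iff (hne _)]
end
end

section
/- Let J ⊆ [d+1] be a union of bases of 𝓜 with complement J^C = {i_1,…,i_r}, and let T^0 = type_V(0), so T^0_i = {j ∈ [n] : i ∈ B_j}. Then the type of the point −e_J = −Σ_{i∈J} e_i with respect to V is (T_1,…,T_{d+1}) with T_j = T^0_j ∖ (T^0_{i_1} ∪ ⋯ ∪ T^0_{i_r}) if j ∈ J, and T_j = T^0_j ∪ ((T^0_{i_1})^C ∩ ⋯ ∩ (T^0_{i_r})^C) if j ∈ J^C, where complements of the T^0-sets are taken inside [n]. -/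
open Finset

noncomputable section

variable {d n : ℕ}

theorem IsSpanningTreeEdges.nonempty {W : Type*} {G : SimpleGraph W}
    {ε : Fin (d + 1) ≃ G.edgeSet} {B : Finset (Fin (d + 1))}
    (h : IsSpanningTreeEdges G ε B) : B.Nonempty := by
  rw [Finset.nonempty_iff_ne_empty]
  rintro rfl
  have key : ∀ e : Sym2 W, e ∉ G.edgeSet := by
    intro e
    induction e with
    | _ u v =>
      intro he
      have hbot : edgeGraph G ε ∅ = ⊥ := by simp [edgeGraph]
      have hr := h.connected.preconnected u v
      rw [hbot, SimpleGraph.reachable_bot] at hr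
      exact (G.mem_edgeSet.1 he).ne hr
  exact key _ (ε 0).2

theorem ciInf_eq_of_forall_le_of_eq {ι : Type*} {f : ι → ℝ} {a : ℝ} (i : ι)
    (h : ∀ j, a ≤ f j) (hi : f i = a) : ⨅ j, f j = a :=
  IsLeast.csInf_eq ⟨⟨i, hi⟩, by rintro _ ⟨j, rfl⟩; exact h j⟩

/-- The minimal coordinate of a generator relative to `-e_J`. -/
theorem iInf_gen_sub {Bs : Fin n → Finset (Fin (d + 1))} {l : Fin n} (hB : (Bs l).Nonempty)
    (J : Finset (Fin (d + 1))) :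
    ⨅ j, (gen Bs l j - if j ∈ J then (-1 : ℝ) else 0) = if Bs l ⊆ J then 1 else 0 := by
  split_ifs with h
  · obtain ⟨i, hi⟩ := hB
    refine ciInf_eq_of_forall_le_of_eq i (fun j => ?_) (by simp [gen, hi, h hi])
    by_cases hj : j ∈ Bs l
    · simp [gen, hj, h hj]
    · simp only [gen, hj, if_false]
      split_ifs <;> norm_num
  · obtain ⟨i, hi, hiJ⟩ := Finset.not_subset.1 h
    refine ciInf_eq_of_forall_le_of_eq i (fun j => ?_) (by simp [gen, hi, hiJ])
    unfold gen
    split_ifs <;> norm_num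

/-- The type of the pseudovertex `-e_J`, where `J` is a union of bases:
for `j ∈ J` the `j`-th entry is `T⁰_j ∖ ⋃_{i ∉ J} T⁰_i`, and for `j ∉ J` it is
`T⁰_j ∪ ⋂_{i ∉ J} (T⁰_i)ᶜ`, where `T⁰_i = {l : i ∈ B_l}` is the type of the origin. -/
theorem type_pseudovertex_tropicalMatroidPolytope
    (d n k : ℕ) (W : Type) [Fintype W] (G : SimpleGraph W)
    (ε : Fin (d + 1) ≃ G.edgeSet) (Bs : Fin n → Finset (Fin (d + 1)))
    (hM : MatroidData d n k W G ε Bs)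
    (J : Finset (Fin (d + 1))) (hJ : ∃ S : Finset (Fin n), J = S.biUnion Bs) :
    ∀ j : Fin (d + 1),
      typeEntry (gen Bs) (fun m => if m ∈ J then (-1 : ℝ) else 0) j =
        if j ∈ J then
          {l : Fin n | j ∈ Bs l} \ ⋃ (i : Fin (d + 1)) (_ : i ∉ J), {l : Fin n | i ∈ Bs l}
        else
          {l : Fin n | j ∈ Bs l} ∪ ⋂ (i : Fin (d + 1)) (_ : i ∉ J), {l : Fin n | i ∈ Bs l}ᶜ := by
  intro j
  ext l
  have hsub : Bs l ⊆ J ↔ ∀ i, i ∉ J → i ∉ Bs l :=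
    ⟨fun h i hi hB => hi (h hB), fun h i hB => by_contra fun hi => h i hi hB⟩
  simp only [typeEntry, Set.mem_ofPred_eq, iInf_gen_sub (hM.tree l).nonempty J]
  by_cases hj : j ∈ J
  · simp only [hj, if_true, Set.mem_sdiff, Set.mem_iUnion, Set.mem_ofPred_eq, not_exists, ← hsub]
    by_cases hB : j ∈ Bs l <;> by_cases h : Bs l ⊆ J <;> simp [gen, hB, h]
  · simp only [hj, if_false, Set.mem_union, Set.mem_iInter, Set.mem_compl_iff, Set.mem_ofPred_eq,
      ← hsub]
    by_cases hB : j ∈ Bs l <;> by_cases h : Bs l ⊆ J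
    · exact absurd (h hB) hj
    all_goals simp [gen, hB, h]
end
end

section
/- Assume k ≥ 2. A point x ∈ 𝕋^d is a pseudovertex of the tropical complex 𝒞_V of the tropical matroid polytope P if and only if x is (a representative of) −e_J = −Σ_{i∈J} e_i for some subset J ⊆ [d+1] that is a union of bases of 𝓜, i.e. J = ∪_{i∈I} B_i for some I ⊆ [n]. -/
open Finset

noncomputable section

variable {d n : ℕ}

theorem SimpleGraph.isAcyclic_fromEdgeSet_pair {W : Type*} (e f : Sym2 W) :
    (SimpleGraph.fromEdgeSet {e, f}).IsAcyclic := by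
  classical
  intro w p hp
  have hsub : p.edges.toFinset ⊆ {e, f} := by
    intro s hs
    have := p.edges_subset_edgeSet (List.mem_toFinset.mp hs)
    rw [SimpleGraph.edgeSet_fromEdgeSet] at this
    simpa using this.1
  have hcard := (Finset.card_le_card hsub).trans Finset.card_le_two
  rw [List.toFinset_card_of_nodup hp.edges_nodup, SimpleGraph.Walk.length_edges] at hcard
  have := hp.three_le_length
  omega

/-- Any two edges of a connected simple graph lie in a common spanning tree. -/
theorem exists_isSpanningTreeEdges_mem_mem {W : Type*} {G : SimpleGraph W} (hG : G.Connected)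
    (ε : Fin (d + 1) ≃ G.edgeSet) (i j : Fin (d + 1)) :
    ∃ B, IsSpanningTreeEdges G ε B ∧ i ∈ B ∧ j ∈ B := by
  classical
  have hle : SimpleGraph.fromEdgeSet {(ε i : Sym2 W), (ε j : Sym2 W)} ≤ G := by
    rw [SimpleGraph.fromEdgeSet_le]
    rintro s ⟨rfl | rfl, -⟩
    exacts [(ε i).2, (ε j).2]
  obtain ⟨F, hF, hFG, hT⟩ := hG.exists_isTree_le_of_le_of_isAcyclic hle
    (SimpleGraph.isAcyclic_fromEdgeSet_pair _ _)
  have hmem : ∀ a, (ε a : Sym2 W) ∈ ({(ε i : Sym2 W), (ε j : Sym2 W)} : Set (Sym2 W)) →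
      (ε a : Sym2 W) ∈ F.edgeSet := fun a ha =>
    SimpleGraph.edgeSet_mono hF (by
      rw [SimpleGraph.edgeSet_fromEdgeSet]
      exact ⟨ha, G.not_isDiag_of_mem_edgeSet (ε a).2⟩)
  refine ⟨univ.filter fun a => (ε a : Sym2 W) ∈ F.edgeSet, ?_,
    by simpa using hmem i (by simp), by simpa using hmem j (by simp)⟩
  have hset : {s | ∃ a ∈ univ.filter fun a => (ε a : Sym2 W) ∈ F.edgeSet, (ε a : Sym2 W) = s} =
      F.edgeSet := by
    ext s
    constructor
    · rintro ⟨a, ha, rfl⟩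
      exact (mem_filter.mp ha).2
    · intro hs
      have hε : (ε (ε.symm ⟨s, SimpleGraph.edgeSet_mono hFG hs⟩) : Sym2 W) = s := by simp
      exact ⟨_, mem_filter.mpr ⟨mem_univ _, hε.symm ▸ hs⟩, hε⟩
  rw [IsSpanningTreeEdges, edgeGraph, hset, SimpleGraph.fromEdgeSet_edgeSet]
  exact hT

theorem mem_typeEntry_iff {ι : Type*} {v : ι → Fin (d + 1) → ℝ} {x : Fin (d + 1) → ℝ}
    {k : Fin (d + 1)} {l : ι} :
    l ∈ typeEntry v x k ↔ ∀ j, v l k - x k ≤ v l j - x j := by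
  have hb : BddBelow (Set.range fun j => v l j - x j) := (Set.finite_range _).bddBelow
  change v l k - x k = ⨅ j, (v l j - x j) ↔ _
  exact ⟨fun h j => h ▸ ciInf_le hb j, fun h => le_antisymm (le_ciInf h) (ciInf_le hb k)⟩

theorem sub_eq_of_mem_typeEntry {ι : Type*} {v : ι → Fin (d + 1) → ℝ} {x : Fin (d + 1) → ℝ}
    {i j : Fin (d + 1)} {l : ι} (hi : l ∈ typeEntry v x i) (hj : l ∈ typeEntry v x j) :
    v l i - x i = v l j - x j :=
  le_antisymm (mem_typeEntry_iff.mp hi j) (mem_typeEntry_iff.mp hj i)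

theorem exists_mem_typeEntry {ι : Type*} (v : ι → Fin (d + 1) → ℝ) (x : Fin (d + 1) → ℝ)
    (l : ι) : ∃ j, l ∈ typeEntry v x j := by
  obtain ⟨j, hj⟩ := Finite.exists_min fun j => v l j - x j
  exact ⟨j, mem_typeEntry_iff.mpr hj⟩

/-- A point is a pseudovertex if every coordinate shares a generator of its type with
a fixed coordinate. -/
theorem isPseudovertex_of_forall_common {ι : Type*} {v : ι → Fin (d + 1) → ℝ}
    {x : Fin (d + 1) → ℝ} (t : Fin (d + 1))
    (h : ∀ j, ∃ l, l ∈ typeEntry v x t ∧ l ∈ typeEntry v x j) : IsPseudovertex v x := by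
  intro y hy
  refine ⟨y t - x t, funext fun j => ?_⟩
  obtain ⟨l, ht, hj⟩ := h j
  have h₁ := sub_eq_of_mem_typeEntry ht hj
  have h₂ := sub_eq_of_mem_typeEntry ((hy t).symm ▸ ht) ((hy j).symm ▸ hj)
  linarith

/-- The coordinates of a pseudovertex cannot be split into two nonempty parts such that no
generator occurs in the type in both parts. -/
theorem IsPseudovertex.eq_univ_of_closed {ι : Type*} [Finite ι] {v : ι → Fin (d + 1) → ℝ}
    {x : Fin (d + 1) → ℝ} (hx : IsPseudovertex v x) {C : Set (Fin (d + 1))} (hC : C.Nonempty)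
    (hclosed : ∀ l i j, l ∈ typeEntry v x i → l ∈ typeEntry v x j → i ∈ C → j ∈ C) :
    C = Set.univ := by
  classical
  have hev : ∀ᶠ δ : ℝ in nhdsWithin 0 (Set.Ioi 0), ∀ l i j,
      v l j - x j < v l i - x i → v l j - x j < v l i - x i - δ := by
    simp only [Filter.eventually_all]
    intro l i j h
    filter_upwards [nhdsWithin_le_nhds (Iio_mem_nhds (sub_pos.mpr h))] with δ hδ
    linarith [Set.mem_Iio.mp hδ]
  obtain ⟨δ, hδ, hpos⟩ := (hev.and self_mem_nhdsWithin).exists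
  have hpos : 0 < δ := hpos
  have hy : ∀ k, typeEntry v (fun i => x i + if i ∈ C then δ else 0) k = typeEntry v x k := by
    intro k
    ext l
    constructor
    · intro hk
      by_contra hn
      obtain ⟨j, hj⟩ := exists_mem_typeEntry v x l
      have hlt : v l j - x j < v l k - x k := by
        by_contra! hle
        exact hn (mem_typeEntry_iff.mpr fun i => hle.trans (mem_typeEntry_iff.mp hj i))
      have h₁ := hδ l k j hlt
      have h₂ := mem_typeEntry_iff.mp hk j
      split_ifs at h₂ <;> linarith
    · intro hk
      refine mem_typeEntry_iff.mpr fun j => ?_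
      have hle := mem_typeEntry_iff.mp hk j
      by_cases hj : l ∈ typeEntry v x j
      · have := hclosed l k j hk hj
        have := hclosed l j k hj hk
        split_ifs <;> first | linarith | tauto
      · have hlt : v l k - x k < v l j - x j := by
          by_contra! hle'
          exact hj (mem_typeEntry_iff.mpr fun i => hle'.trans (mem_typeEntry_iff.mp hk i))
        have := hδ l j k hlt
        split_ifs <;> linarith
  obtain ⟨c, hc⟩ := hx _ hy
  obtain ⟨i, hi⟩ := hC
  refine Set.eq_univ_of_forall fun j => ?_
  by_contra hj
  have h₁ := congrFun hc i
  have h₂ := congrFun hc j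
  simp only [hi, hj, if_true, if_false] at h₁ h₂
  linarith

/-- If any two coordinates lie in a common basis, then `-e_J` is a pseudovertex for every union
`J` of bases. -/
theorem isPseudovertex_gen_of_biUnion {Bs : Fin n → Finset (Fin (d + 1))}
    (hpair : ∀ i j, ∃ l, i ∈ Bs l ∧ j ∈ Bs l) (S : Finset (Fin n)) (c : ℝ) :
    IsPseudovertex (gen Bs) fun i => (if i ∈ S.biUnion Bs then (-1 : ℝ) else 0) + c := by
  by_cases hconst : ∃ a : ℝ, ∀ i, (if i ∈ S.biUnion Bs then (-1 : ℝ) else 0) = a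
  · obtain ⟨a, ha⟩ := hconst
    refine isPseudovertex_of_forall_common 0 fun j => ?_
    obtain ⟨l, h₀, hj⟩ := hpair 0 j
    refine ⟨l, mem_typeEntry_iff.mpr fun i => ?_, mem_typeEntry_iff.mpr fun i => ?_⟩ <;>
    · simp only [ha, gen, h₀, hj, if_true]
      split_ifs <;> linarith
  · have hout : ∃ t, t ∉ S.biUnion Bs := by
      by_contra! h
      exact hconst ⟨-1, fun i => if_pos (h i)⟩
    have hin : ∃ s, s ∈ S.biUnion Bs := by
      by_contra! h
      exact hconst ⟨0, fun i => if_neg (h i)⟩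
    obtain ⟨t, ht⟩ := hout
    obtain ⟨s, hs⟩ := hin
    obtain ⟨l₀, hl₀, -⟩ := mem_biUnion.mp hs
    have hsub : ∀ l ∈ S, ∀ i, i ∉ S.biUnion Bs → i ∉ Bs l := fun l hl i hi hil =>
      hi (mem_biUnion.mpr ⟨l, hl, hil⟩)
    have houter : ∀ l ∈ S, ∀ i, i ∉ S.biUnion Bs → l ∈ typeEntry (gen Bs)
        (fun i => (if i ∈ S.biUnion Bs then (-1 : ℝ) else 0) + c) i := by
      intro l hl i hi
      refine mem_typeEntry_iff.mpr fun j => ?_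
      have := hsub l hl j
      simp only [gen, hsub l hl i hi, hi, if_false]
      split_ifs <;> first | linarith | tauto
    refine isPseudovertex_of_forall_common t fun j => ?_
    by_cases hj : j ∈ S.biUnion Bs
    · obtain ⟨l, hl, hjl⟩ := mem_biUnion.mp hj
      refine ⟨l, houter l hl t ht, mem_typeEntry_iff.mpr fun i => ?_⟩
      have := hsub l hl i
      simp only [gen, hjl, hj, if_true]
      split_ifs <;> first | linarith | tauto
    · exact ⟨l₀, houter l₀ hl₀ t ht, houter l₀ hl₀ j hj⟩

theorem IsPseudovertex.exists_eq_biUnion {Bs : Fin n → Finset (Fin (d + 1))}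
    {x : Fin (d + 1) → ℝ} (hx : IsPseudovertex (gen Bs) x) :
    ∃ (S : Finset (Fin n)) (c : ℝ),
      x = fun i => (if i ∈ S.biUnion Bs then (-1 : ℝ) else 0) + c := by
  classical
  obtain ⟨t, ht⟩ := Finite.exists_max x
  have hgen : ∀ l i, gen Bs l i = 0 ∨ gen Bs l i = 1 := fun l i => by
    unfold gen; split_ifs <;> simp
  have hval : {i | x i = x t ∨ x i = x t - 1} = Set.univ := by
    refine hx.eq_univ_of_closed ⟨t, Or.inl rfl⟩ fun l i j hi hj hiC => ?_
    have h := sub_eq_of_mem_typeEntry hi hj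
    have hjt := mem_typeEntry_iff.mp hj t
    have hmax := ht j
    simp only [Set.mem_ofPred_eq] at hiC ⊢
    rcases hiC with hiC | hiC <;> rcases hgen l i with a | a <;> rcases hgen l j with b | b <;>
      rcases hgen l t with e | e <;> rw [a, b] at h <;> rw [b, e] at hjt <;>
      first
      | (exfalso; linarith)
      | (left; linarith)
      | (right; linarith)
  have hval : ∀ i, x i = x t ∨ x i = x t - 1 := fun i => Set.eq_univ_iff_forall.mp hval i
  refine ⟨univ.filter fun l => ∀ i ∈ Bs l, x i = x t - 1, x t, funext fun j => ?_⟩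
  split_ifs with hj
  · obtain ⟨l, hl, hjl⟩ := mem_biUnion.mp hj
    linarith [(mem_filter.mp hl).2 j hjl]
  · rcases hval j with h | h
    · linarith
    · exfalso
      have hl : ∃ l, l ∈ typeEntry (gen Bs) x j := by
        by_contra! hn
        have := hx.eq_univ_of_closed (Set.singleton_nonempty j) fun l i _ hi _ hij =>
          absurd (Set.mem_singleton_iff.mp hij ▸ hi) (hn l)
        have htj : t = j := Set.eq_univ_iff_forall.mp this t
        rw [htj] at h
        linarith
      obtain ⟨l, hl⟩ := hl
      have hlj := mem_typeEntry_iff.mp hl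
      have hjl : j ∈ Bs l := by
        by_contra hjl
        have := hlj t
        have hj1 : gen Bs l j = 1 := if_neg hjl
        rcases hgen l t with e | e <;> linarith
      refine hj (mem_biUnion.mpr ⟨l, mem_filter.mpr ⟨mem_univ _, fun i hi => ?_⟩, hjl⟩)
      have := hlj i
      have hj0 : gen Bs l j = 0 := if_pos hjl
      have hi0 : gen Bs l i = 0 := if_pos hi
      rcases hval i with e | e <;> linarith

/-- For rank `k ≥ 2`, the pseudovertices of the tropical complex of the
tropical matroid polytope are exactly the representatives of the points `-e_J` where
`J` is a union of bases. -/
theorem pseudovertices_tropicalMatroidPolytope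
    (d n k : ℕ) (W : Type) [Fintype W] (G : SimpleGraph W)
    (ε : Fin (d + 1) ≃ G.edgeSet) (Bs : Fin n → Finset (Fin (d + 1)))
    (hM : MatroidData d n k W G ε Bs) (hk : 2 ≤ k) :
    ∀ x : Fin (d + 1) → ℝ,
      IsPseudovertex (gen Bs) x ↔
        ∃ (S : Finset (Fin n)) (c : ℝ),
          x = fun i => (if i ∈ S.biUnion Bs then (-1 : ℝ) else 0) + c := by
  refine fun x => ⟨IsPseudovertex.exists_eq_biUnion, ?_⟩
  rintro ⟨S, c, rfl⟩
  refine isPseudovertex_gen_of_biUnion (fun i j => ?_) S c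
  obtain ⟨B, hB, hi, hj⟩ := exists_isSpanningTreeEdges_mem_mem hM.connected ε i j
  obtain ⟨l, rfl⟩ := hM.all B hB
  exact ⟨l, hi, hj⟩
end
end

section
/- The tropical complex 𝒞_V of a tropical matroid polytope with d+1 elements, rank k and n bases has exactly n·(d+1−k)! inclusion-maximal bounded cells. -/
open Finset

noncomputable section

variable {d n : ℕ}

section SpanningTrees

variable {W : Type*} {G : SimpleGraph W} {ε : Fin (d + 1) ≃ G.edgeSet}

lemma mem_edgeSet_edgeGraph {B : Finset (Fin (d + 1))} {s : Sym2 W} :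
    s ∈ (edgeGraph G ε B).edgeSet ↔ ∃ i ∈ B, (ε i : Sym2 W) = s := by
  rw [edgeGraph, SimpleGraph.edgeSet_fromEdgeSet]
  constructor
  · exact fun h => h.1
  · rintro ⟨i, hi, rfl⟩
    exact ⟨⟨i, hi, rfl⟩, G.not_isDiag_of_mem_edgeSet (ε i).2⟩

lemma edgeGraph_mono {B C : Finset (Fin (d + 1))} (h : B ⊆ C) :
    edgeGraph G ε B ≤ edgeGraph G ε C := by
  rw [← SimpleGraph.edgeSet_subset_edgeSet]
  intro s hs
  obtain ⟨i, hi, rfl⟩ := mem_edgeSet_edgeGraph.1 hs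
  exact mem_edgeSet_edgeGraph.2 ⟨i, h hi, rfl⟩

lemma exists_edgeGraph_eq {T : SimpleGraph W} (hT : T ≤ G) :
    ∃ B : Finset (Fin (d + 1)), edgeGraph G ε B = T := by
  classical
  refine ⟨Finset.univ.filter fun i => (ε i : Sym2 W) ∈ T.edgeSet, ?_⟩
  rw [← SimpleGraph.edgeSet_inj]
  ext s
  rw [mem_edgeSet_edgeGraph]
  constructor
  · rintro ⟨i, hi, rfl⟩
    simpa using hi
  · intro hs
    have hG : s ∈ G.edgeSet := SimpleGraph.edgeSet_mono hT hs
    exact ⟨ε.symm ⟨s, hG⟩, by simpa using hs, by simp⟩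

/-- Two edges of a simple graph never contain a cycle. -/
lemma isAcyclic_edgeGraph_pair (i j : Fin (d + 1)) : (edgeGraph G ε {i, j}).IsAcyclic := by
  classical
  intro v c hc
  have hsub : c.edges.toFinset ⊆ {(ε i : Sym2 W), (ε j : Sym2 W)} := by
    intro s hs
    have := c.edges_subset_edgeSet (List.mem_toFinset.1 hs)
    obtain ⟨e, he, rfl⟩ := mem_edgeSet_edgeGraph.1 this
    rcases Finset.mem_insert.1 he with rfl | he
    · simp
    · simp [Finset.mem_singleton.1 he]
  have h1 := Finset.card_le_card hsub
  rw [List.toFinset_card_of_nodup hc.edges_nodup, SimpleGraph.Walk.length_edges] at h1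
  have h2 := hc.three_le_length
  have h3 := Finset.card_le_two (a := (ε i : Sym2 W)) (b := (ε j : Sym2 W))
  omega

/-- Two elements of the ground set can be exchanged into any spanning tree. -/
lemma IsSpanningTreeEdges.exists_pair_mem {B : Finset (Fin (d + 1))}
    (hB : IsSpanningTreeEdges G ε B) (i j : Fin (d + 1)) :
    ∃ C, IsSpanningTreeEdges G ε C ∧ i ∈ C ∧ j ∈ C ∧ ∀ e ∈ C, e ∈ B ∨ e = i ∨ e = j := by
  classical
  have hconn : (edgeGraph G ε (B ∪ {i, j})).Connected :=
    hB.connected.mono (edgeGraph_mono Finset.subset_union_left)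
  obtain ⟨F, hF1, hF2, hF⟩ := hconn.exists_isTree_le_of_le_of_isAcyclic
    (edgeGraph_mono Finset.subset_union_right) (isAcyclic_edgeGraph_pair i j)
  have hle : edgeGraph G ε (B ∪ {i, j}) ≤ G := by
    rw [← SimpleGraph.edgeSet_subset_edgeSet]
    intro s hs
    obtain ⟨e, -, rfl⟩ := mem_edgeSet_edgeGraph.1 hs
    exact (ε e).2
  obtain ⟨C, rfl⟩ := exists_edgeGraph_eq (ε := ε) (hF2.trans hle)
  have key : ∀ {D E : Finset (Fin (d + 1))}, edgeGraph G ε D ≤ edgeGraph G ε E → D ⊆ E := by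
    intro D E h e he
    obtain ⟨e', he', h'⟩ := mem_edgeSet_edgeGraph.1
      (SimpleGraph.edgeSet_mono h (mem_edgeSet_edgeGraph.2 ⟨e, he, rfl⟩))
    rwa [← ε.injective (Subtype.ext h')]
  refine ⟨C, hF, key hF1 (by simp), key hF1 (by simp), fun e he => ?_⟩
  simpa [or_comm, or_assoc, or_left_comm] using key hF2 he

end SpanningTrees

section Cells

lemma mem_typeEntry {ι : Type*} {v : ι → Fin (d + 1) → ℝ} {x : Fin (d + 1) → ℝ}
    {k : Fin (d + 1)} {i : ι} :
    i ∈ typeEntry v x k ↔ ∀ j, v i k - x k ≤ v i j - x j := by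
  have hbdd : BddBelow (Set.range fun j => v i j - x j) := (Set.finite_range _).bddBelow
  constructor
  · intro h j
    exact (show v i k - x k = _ from h).le.trans (ciInf_le hbdd j)
  · intro h
    exact le_antisymm (le_ciInf h) (ciInf_le hbdd k)

lemma mem_closedCell_self {ι : Type*} (v : ι → Fin (d + 1) → ℝ) (p : Fin (d + 1) → ℝ) :
    p ∈ closedCell v p := fun _ => subset_rfl

lemma closedCell_subset {ι : Type*} {v : ι → Fin (d + 1) → ℝ} {p q : Fin (d + 1) → ℝ}
    (h : q ∈ closedCell v p) : closedCell v q ⊆ closedCell v p :=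
  fun _ hy k => (h k).trans (hy k)

/-- Bounded cells consist of points all of whose type entries are non-empty. -/
lemma typeEntry_nonempty_of_isBounded {ι : Type*} [Nonempty ι] {v : ι → Fin (d + 1) → ℝ}
    {q : Fin (d + 1) → ℝ} (h : Bornology.IsBounded (chart '' closedCell v q))
    (k : Fin (d + 1)) : (typeEntry v q k).Nonempty := by
  by_contra hne
  rw [Set.not_nonempty_iff_eq_empty] at hne
  have hlow : ∀ t : ℝ, 0 ≤ t → Function.update q k (q k - t) ∈ closedCell v q := by
    intro t ht m i hi
    have hmk : m ≠ k := by
      rintro rfl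
      simp [hne] at hi
    rw [mem_typeEntry] at hi ⊢
    intro j
    rw [Function.update_of_ne hmk]
    by_cases hj : j = k
    · subst hj
      rw [Function.update_self]
      linarith [hi j]
    · rw [Function.update_of_ne hj]
      exact hi j
  obtain ⟨C, hC⟩ := isBounded_iff_forall_norm_le.1 h
  have hcoord : ∀ t : ℝ, 0 ≤ t → ∀ m : Fin d,
      |Function.update q k (q k - t) m.succ - Function.update q k (q k - t) 0| ≤ C :=
    fun t ht m => (norm_le_pi_norm (chart _) m).trans (hC _ ⟨_, hlow t ht, rfl⟩)
  induction k using Fin.cases with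
  | succ m =>
    have h1 := hcoord (|C| + |q m.succ - q 0| + 1) (by positivity) m
    rw [Function.update_self, Function.update_of_ne (Fin.succ_ne_zero m).symm] at h1
    have := (abs_le.1 h1).1
    linarith [le_abs_self C, le_abs_self (q m.succ - q 0)]
  | zero =>
    rcases Nat.eq_zero_or_pos d with rfl | hd
    · obtain ⟨i⟩ := ‹Nonempty ι›
      have : i ∈ typeEntry v q 0 := mem_typeEntry.2 fun j => by
        rw [Fin.fin_one_eq_zero j]
      simp [hne] at this
    · have h1 := hcoord (|C| + |q (Fin.succ ⟨0, hd⟩) - q 0| + 1) (by positivity) ⟨0, hd⟩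
      rw [Function.update_self, Function.update_of_ne (Fin.succ_ne_zero _)] at h1
      have := (abs_le.1 h1).2
      linarith [le_abs_self C, neg_abs_le (q (Fin.succ ⟨0, hd⟩) - q 0)]

variable {Bs : Fin n → Finset (Fin (d + 1))} {k : ℕ}

/-- The cell of a point that vanishes on a basis and has all coordinates in `[0, 1)` is cut out
by the weak order of the coordinates. -/
lemma mem_closedCell_gen_iff
    (hpair : ∀ l i j, ∃ l', i ∈ Bs l' ∧ j ∈ Bs l' ∧ ∀ e ∈ Bs l', e ∈ Bs l ∨ e = i ∨ e = j)
    (hne : ∀ l, (Bs l).Nonempty) {l : Fin n} {p : Fin (d + 1) → ℝ} (hp0 : ∀ j, 0 ≤ p j)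
    (hp1 : ∀ j, p j < 1) (hpB : ∀ j ∈ Bs l, p j = 0) (y : Fin (d + 1) → ℝ) :
    y ∈ closedCell (gen Bs) p ↔
      (∀ i j, p i ≤ p j → y i ≤ y j) ∧ ∀ i j, y i ≤ y j + 1 := by
  constructor
  · intro hy
    have hord : ∀ i j, p i ≤ p j → y i ≤ y j := by
      intro i j hij
      obtain ⟨l', hi, hj, hsub⟩ := hpair l i j
      have hl' : l' ∈ typeEntry (gen Bs) p j := by
        rw [mem_typeEntry]
        intro e
        by_cases he : e ∈ Bs l'
        · have : p e ≤ p j := by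
            rcases hsub e he with h | rfl | rfl
            · rw [hpB e h]; exact hp0 j
            · exact hij
            · exact le_rfl
          simp only [gen, he, hj, if_true]
          linarith
        · simp only [gen, he, hj, if_true, if_false]
          linarith [hp0 j, hp1 e]
      have := mem_typeEntry.1 (hy j hl') i
      simp only [gen, hi, hj, if_true] at this
      linarith
    refine ⟨hord, fun i j => ?_⟩
    obtain ⟨b, hb⟩ := hne l
    have hl : l ∈ typeEntry (gen Bs) p b := by
      rw [mem_typeEntry]
      intro e
      by_cases he : e ∈ Bs l
      · simp [gen, he, hb, hpB]
      · simp only [gen, he, hb, if_true, if_false, hpB b hb]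
        linarith [hp1 e]
    have h1 := mem_typeEntry.1 (hy b hl) i
    have h2 : gen Bs l i ≤ 1 := by unfold gen; split_ifs <;> norm_num
    have h3 := hord b j (by rw [hpB b hb]; exact hp0 j)
    simp only [gen, hb, if_true] at h1 h2
    linarith
  · rintro ⟨hord, hone⟩ m l' hl'
    rw [mem_typeEntry] at hl' ⊢
    have hm : m ∈ Bs l' := by
      by_contra hm
      obtain ⟨e, he⟩ := hne l'
      have := hl' e
      simp only [gen, he, hm, if_true, if_false] at this
      linarith [hp0 e, hp1 m]
    intro e
    have h1 := hl' e
    by_cases he : e ∈ Bs l'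
    · simp only [gen, he, hm, if_true] at h1 ⊢
      linarith [hord e m (by linarith)]
    · simp only [gen, he, hm, if_true, if_false] at h1 ⊢
      linarith [hone e m]

lemma card_compl_basis (hcard : ∀ l, (Bs l).card = k) (l : Fin n) :
    Fintype.card {j // j ∉ Bs l} = d + 1 - k := by
  simp [Fintype.card_subtype_compl, hcard]

/-- an enumeration of the complement of a basis -/
def complEquiv (hcard : ∀ l, (Bs l).card = k) (l : Fin n) :
    {j // j ∉ Bs l} ≃ Fin (d + 1 - k) :=
  Fintype.equivFinOfCardEq (card_compl_basis hcard l)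

/-- a point which vanishes exactly on the basis `Bs l`, and whose coordinates off the basis are
distinct elements of `(0, 1)`, in the order prescribed by the permutation `τ` -/
def orderPoint (hcard : ∀ l, (Bs l).card = k) (l : Fin n)
    (τ : Equiv.Perm (Fin (d + 1 - k))) (j : Fin (d + 1)) : ℝ :=
  if h : j ∈ Bs l then 0
  else ((τ (complEquiv hcard l ⟨j, h⟩) : ℕ) + 1 : ℝ) / ((d + 1 - k : ℕ) + 1)

variable (hcard : ∀ l, (Bs l).card = k) (l : Fin n) (τ : Equiv.Perm (Fin (d + 1 - k)))

lemma orderPoint_of_mem {j : Fin (d + 1)} (h : j ∈ Bs l) : orderPoint hcard l τ j = 0 := by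
  simp [orderPoint, h]

lemma orderPoint_pos_of_notMem {j : Fin (d + 1)} (h : j ∉ Bs l) :
    0 < orderPoint hcard l τ j := by
  rw [orderPoint, dif_neg h]
  positivity

lemma orderPoint_nonneg (j : Fin (d + 1)) : 0 ≤ orderPoint hcard l τ j := by
  by_cases h : j ∈ Bs l
  · exact (orderPoint_of_mem hcard l τ h).ge
  · exact (orderPoint_pos_of_notMem hcard l τ h).le

lemma orderPoint_lt_one (j : Fin (d + 1)) : orderPoint hcard l τ j < 1 := by
  unfold orderPoint
  split_ifs with h
  · norm_num
  · rw [div_lt_one (by positivity)]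
    have := (τ (complEquiv hcard l ⟨j, h⟩)).2
    gcongr

lemma orderPoint_le_iff {i j : Fin (d + 1)} (hi : i ∉ Bs l) (hj : j ∉ Bs l) :
    orderPoint hcard l τ i ≤ orderPoint hcard l τ j ↔
      τ (complEquiv hcard l ⟨i, hi⟩) ≤ τ (complEquiv hcard l ⟨j, hj⟩) := by
  rw [orderPoint, orderPoint, dif_neg hi, dif_neg hj, div_le_div_iff_of_pos_right (by positivity)]
  simp

/-- Comparability of the order cells forces equality of their data. -/
lemma eq_of_orderPoint_mem_closedCell (hinj : Function.Injective Bs)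
    (hpair : ∀ l i j, ∃ l', i ∈ Bs l' ∧ j ∈ Bs l' ∧ ∀ e ∈ Bs l', e ∈ Bs l ∨ e = i ∨ e = j)
    (hne : ∀ l, (Bs l).Nonempty) {l l' : Fin n} {τ τ' : Equiv.Perm (Fin (d + 1 - k))}
    (h : orderPoint hcard l τ ∈ closedCell (gen Bs) (orderPoint hcard l' τ')) :
    l = l' ∧ τ = τ' := by
  rw [mem_closedCell_gen_iff hpair hne (orderPoint_nonneg hcard l' τ')
    (orderPoint_lt_one hcard l' τ') (fun _ => orderPoint_of_mem hcard l' τ')] at h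
  have hsub : Bs l' ⊆ Bs l := by
    intro b' hb'
    obtain ⟨b, hb⟩ := hne l
    by_contra hb'l
    have h1 := h.1 b' b (by
      rw [orderPoint_of_mem hcard l' τ' hb']
      exact orderPoint_nonneg hcard l' τ' b)
    rw [orderPoint_of_mem hcard l τ hb] at h1
    exact h1.not_gt (orderPoint_pos_of_notMem hcard l τ hb'l)
  obtain rfl : l' = l :=
    hinj (Finset.eq_of_subset_of_card_le hsub (by rw [hcard, hcard]))
  refine ⟨rfl, ?_⟩
  have hmono : ∀ a b, τ' a ≤ τ' b → τ a ≤ τ b := by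
    intro a b hab
    have h1 := h.1 ((complEquiv hcard l').symm a) ((complEquiv hcard l').symm b)
    have ha := ((complEquiv hcard l').symm a).2
    have hb := ((complEquiv hcard l').symm b).2
    rw [orderPoint_le_iff hcard _ _ ha hb, orderPoint_le_iff hcard _ _ ha hb] at h1
    simp only [Subtype.coe_eta, Equiv.apply_symm_apply] at h1
    exact h1 hab
  have hm : Monotone (τ'.symm.trans τ) := fun a b hab => hmono _ _ (by simpa using hab)
  have hs : StrictMono (τ'.symm.trans τ) := hm.strictMono_of_injective (Equiv.injective _)
  have hid : ⇑(τ'.symm.trans τ) = id :=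
    congrArg DFunLike.coe (Subsingleton.elim
      (hs.orderIsoOfSurjective _ (Equiv.surjective _)) (OrderIso.refl _))
  ext a
  have := congrFun hid (τ' a)
  simp only [Equiv.trans_apply, Equiv.symm_apply_apply, id] at this
  rw [this]

lemma isBoundedCell_orderPoint
    (hpair : ∀ l i j, ∃ l', i ∈ Bs l' ∧ j ∈ Bs l' ∧ ∀ e ∈ Bs l', e ∈ Bs l ∨ e = i ∨ e = j)
    (hne : ∀ l, (Bs l).Nonempty) :
    IsBoundedCell (gen Bs) (closedCell (gen Bs) (orderPoint hcard l τ)) := by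
  refine ⟨⟨_, rfl⟩, isBounded_iff_forall_norm_le.2 ⟨1, ?_⟩⟩
  rintro _ ⟨y, hy, rfl⟩
  rw [mem_closedCell_gen_iff hpair hne (orderPoint_nonneg hcard l τ)
    (orderPoint_lt_one hcard l τ) (fun _ => orderPoint_of_mem hcard l τ)] at hy
  rw [pi_norm_le_iff_of_nonneg zero_le_one]
  intro i
  rw [Real.norm_eq_abs, abs_le, chart]
  constructor <;> linarith [hy.2 i.succ 0, hy.2 0 i.succ]

/-- Every bounded cell is contained in the cell of some order point. -/
lemma IsBoundedCell.exists_subset_orderPoint [Nonempty (Fin n)]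
    (hpair : ∀ l i j, ∃ l', i ∈ Bs l' ∧ j ∈ Bs l' ∧ ∀ e ∈ Bs l', e ∈ Bs l ∨ e = i ∨ e = j)
    (hne : ∀ l, (Bs l).Nonempty) {X : Set (Fin (d + 1) → ℝ)} (hX : IsBoundedCell (gen Bs) X) :
    ∃ l τ, X ⊆ closedCell (gen Bs) (orderPoint hcard l τ) := by
  obtain ⟨⟨q, rfl⟩, hb⟩ := hX
  obtain ⟨m, hm⟩ := Finite.exists_min q
  obtain ⟨l, hl⟩ := typeEntry_nonempty_of_isBounded hb m
  rw [mem_typeEntry] at hl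
  have hml : m ∈ Bs l := by
    by_contra hml
    obtain ⟨e, he⟩ := hne l
    have := hl e
    simp only [gen, he, hml, if_true, if_false] at this
    linarith [hm e]
  simp only [gen, hml, if_true] at hl
  have hmin : ∀ e ∈ Bs l, q e = q m := by
    intro e he
    have := hl e
    simp only [he, if_true] at this
    linarith [hm e]
  have hmax : ∀ e, q e ≤ q m + 1 := by
    intro e
    have := hl e
    split_ifs at this <;> linarith
  set σ := Tuple.sort fun a => q ((complEquiv hcard l).symm a) with hσ
  refine ⟨l, σ⁻¹, closedCell_subset ?_⟩
  rw [mem_closedCell_gen_iff hpair hne (orderPoint_nonneg hcard l _)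
    (orderPoint_lt_one hcard l _) (fun _ => orderPoint_of_mem hcard l _)]
  refine ⟨fun i j hij => ?_, fun i j => (hmax i).trans (by linarith [hm j])⟩
  by_cases hi : i ∈ Bs l
  · rw [hmin i hi]
    exact hm j
  · by_cases hj : j ∈ Bs l
    · rw [orderPoint_of_mem hcard l _ hj] at hij
      exact absurd hij (orderPoint_pos_of_notMem hcard l _ hi).not_ge
    · rw [orderPoint_le_iff hcard l _ hi hj] at hij
      have := Tuple.monotone_sort (fun a => q ((complEquiv hcard l).symm a)) hij
      simpa [← hσ] using this

end Cells

/-- The tropical complex of a tropical matroid polytope with `d+1`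
elements, rank `k` and `n` bases has exactly `n · (d+1-k)!` inclusion-maximal bounded
cells. -/
theorem card_maxBoundedCells_tropicalMatroidPolytope
    (d n k : ℕ) (W : Type) [Fintype W] (G : SimpleGraph W)
    (ε : Fin (d + 1) ≃ G.edgeSet) (Bs : Fin n → Finset (Fin (d + 1)))
    (hM : MatroidData d n k W G ε Bs) :
    {X : Set (Fin (d + 1) → ℝ) | IsMaxBoundedCell (gen Bs) X}.ncard =
      n * Nat.factorial (d + 1 - k) := by
  classical
  have hpair : ∀ l i j, ∃ l', i ∈ Bs l' ∧ j ∈ Bs l' ∧ ∀ e ∈ Bs l', e ∈ Bs l ∨ e = i ∨ e = j := by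
    intro l i j
    obtain ⟨C, hC, h⟩ := (hM.tree l).exists_pair_mem i j
    obtain ⟨l', rfl⟩ := hM.all C hC
    exact ⟨l', h⟩
  have hne : ∀ l, (Bs l).Nonempty := by
    intro l
    obtain ⟨l', h, -⟩ := hpair l 0 0
    rw [← Finset.card_pos, hM.card l, ← hM.card l']
    exact Finset.card_pos.2 ⟨0, h⟩
  have : Nonempty (Fin n) := by
    obtain ⟨T, hTG, hT⟩ := hM.connected.exists_isTree_le
    obtain ⟨B, rfl⟩ := exists_edgeGraph_eq (ε := ε) hTG
    exact ⟨(hM.all B hT).choose⟩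
  let f : Fin n × Equiv.Perm (Fin (d + 1 - k)) → Set (Fin (d + 1) → ℝ) :=
    fun a => closedCell (gen Bs) (orderPoint hM.card a.1 a.2)
  have hf : ∀ a b, f a ⊆ f b → a = b := by
    intro a b hab
    obtain ⟨h1, h2⟩ := eq_of_orderPoint_mem_closedCell hM.card hM.inj hpair hne
      (hab (mem_closedCell_self _ _))
    exact Prod.ext h1 h2
  have hset : {X | IsMaxBoundedCell (gen Bs) X} = Set.range f := by
    ext X
    constructor
    · rintro ⟨hX, hmax⟩
      obtain ⟨l, τ, h⟩ := hX.exists_subset_orderPoint hM.card hpair hne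
      exact ⟨(l, τ), hmax _ (isBoundedCell_orderPoint hM.card l τ hpair hne) h⟩
    · rintro ⟨a, rfl⟩
      refine ⟨isBoundedCell_orderPoint hM.card a.1 a.2 hpair hne, fun Y hY haY => ?_⟩
      obtain ⟨l, τ, h⟩ := hY.exists_subset_orderPoint hM.card hpair hne
      obtain rfl := hf a (l, τ) (haY.trans h)
      exact h.antisymm haY
  rw [hset, ← Set.image_univ,
    Set.ncard_image_of_injective _ fun a b hab => hf a b (Eq.subset hab), Set.ncard_univ]
  simp [Nat.card_eq_fintype_card, Fintype.card_perm]
end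
end
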